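/- Let G be a group, g ∈ G, and let H₁, H₂, K₁, K₂ be subgroups of G such that H₁ g K₁ = H₂ g K₂ as subsets of G. Then H₁ g K₁ = H g K, where H is the subgroup generated by H₁ ∪ H₂ and K is the subgroup generated by K₁ ∪ K₂. In particular, for a Coxeter system (W,S) and I, I', J, J' ⊆ S with W_I w W_J = W_{I'} w W_{J'}, one has W_I w W_J = W_{I ∪ I'} w W_{J ∪ J'}. -/

import Mathlib

open CoxeterSystem

/-- The standard parabolic subgroup `W_I` of a Coxeter system, generated by the
simple reflections indexed by `I`. -/
def CoxeterSystem.parabolic {B : Type*} {W : Type*} [Group W] {M : CoxeterMatrix B}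
    (cs : CoxeterSystem M W) (I : Set B) : Subgroup W :=
  Subgroup.closure (cs.simple '' I)

/-- The double coset `H g K` of a group. -/
def grpDoubleCoset {G : Type*} [Group G] (H : Subgroup G) (g : G) (K : Subgroup G) : Set G :=
  {x | ∃ a ∈ H, ∃ b ∈ K, x = a * g * b}

open scoped Pointwise in
theorem le_stabilizer_grpDoubleCoset {G : Type*} [Group G] (H : Subgroup G) (g : G)
    (K : Subgroup G) : H ≤ MulAction.stabilizer G (grpDoubleCoset H g K) := by
  intro h hh
  rw [MulAction.mem_stabilizer_set]
  refine fun x => ⟨?_, ?_⟩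
  · rintro ⟨a, ha, b, hb, hx⟩
    refine ⟨h⁻¹ * a, H.mul_mem (H.inv_mem hh) ha, b, hb, ?_⟩
    rw [smul_eq_mul] at hx
    rw [mul_assoc h⁻¹, mul_assoc h⁻¹, ← hx, inv_mul_cancel_left]
  · rintro ⟨a, ha, b, hb, rfl⟩
    exact ⟨h * a, H.mul_mem hh ha, b, hb, by simp only [smul_eq_mul, mul_assoc]⟩

open scoped Pointwise in
theorem op_le_stabilizer_grpDoubleCoset {G : Type*} [Group G] (H : Subgroup G) (g : G)
    (K : Subgroup G) : K.op ≤ MulAction.stabilizer Gᵐᵒᵖ (grpDoubleCoset H g K) := by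
  intro k hk
  have hk : k.unop ∈ K := hk
  rw [MulAction.mem_stabilizer_set]
  refine fun x => ⟨?_, ?_⟩
  · rintro ⟨a, ha, b, hb, hx⟩
    refine ⟨a, ha, b * k.unop⁻¹, K.mul_mem hb (K.inv_mem hk), ?_⟩
    rw [MulOpposite.smul_eq_mul_unop] at hx
    rw [← mul_assoc, ← hx, mul_inv_cancel_right]
  · rintro ⟨a, ha, b, hb, rfl⟩
    exact ⟨a, ha, b * k.unop, K.mul_mem hb hk, by
      simp only [MulOpposite.smul_eq_mul_unop, mul_assoc]⟩

theorem mem_grpDoubleCoset_self {G : Type*} [Group G] (H : Subgroup G) (g : G)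
    (K : Subgroup G) : g ∈ grpDoubleCoset H g K :=
  ⟨1, H.one_mem, 1, K.one_mem, by simp⟩

theorem grpDoubleCoset_mono {G : Type*} [Group G] {H H' K K' : Subgroup G} (hH : H ≤ H')
    (g : G) (hK : K ≤ K') : grpDoubleCoset H g K ⊆ grpDoubleCoset H' g K' :=
  fun _ ⟨a, ha, b, hb, hx⟩ => ⟨a, hH ha, b, hK hb, hx⟩

open scoped Pointwise in
theorem grpDoubleCoset_eq_sup_of_eq {G : Type*} [Group G] {g : G} {H₁ H₂ K₁ K₂ : Subgroup G}
    (h : grpDoubleCoset H₁ g K₁ = grpDoubleCoset H₂ g K₂) :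
    grpDoubleCoset H₁ g K₁ = grpDoubleCoset (H₁ ⊔ H₂) g (K₁ ⊔ K₂) := by
  refine (grpDoubleCoset_mono le_sup_left g le_sup_left).antisymm ?_
  have hH : H₁ ⊔ H₂ ≤ MulAction.stabilizer G (grpDoubleCoset H₁ g K₁) :=
    sup_le (le_stabilizer_grpDoubleCoset H₁ g K₁) (h ▸ le_stabilizer_grpDoubleCoset H₂ g K₂)
  have hK : (K₁ ⊔ K₂).op ≤ MulAction.stabilizer Gᵐᵒᵖ (grpDoubleCoset H₁ g K₁) := by
    rw [Subgroup.op_sup]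
    exact sup_le (op_le_stabilizer_grpDoubleCoset H₁ g K₁)
      (h ▸ op_le_stabilizer_grpDoubleCoset H₂ g K₂)
  rintro _ ⟨a, ha, b, hb, rfl⟩
  have hag : a * g ∈ grpDoubleCoset H₁ g K₁ :=
    (MulAction.mem_stabilizer_set.1 (hH ha) g).2 (mem_grpDoubleCoset_self H₁ g K₁)
  exact (MulAction.mem_stabilizer_set.1 (hK (x := MulOpposite.op b) hb) (a * g)).2 hag

theorem CoxeterSystem.parabolic_union {B W : Type*} [Group W] {M : CoxeterMatrix B}
    (cs : CoxeterSystem M W) (I J : Set B) :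
    cs.parabolic (I ∪ J) = cs.parabolic I ⊔ cs.parabolic J := by
  simp only [CoxeterSystem.parabolic, Set.image_union, Subgroup.closure_union]

/-- If `H₁ g K₁ = H₂ g K₂`, then this set also equals `H g K` where `H = ⟨H₁ ∪ H₂⟩` and
`K = ⟨K₁ ∪ K₂⟩`.  In particular, for a Coxeter system, if `W_I w W_J = W_{I'} w W_{J'}`
then `W_I w W_J = W_{I ∪ I'} w W_{J ∪ J'}`. -/
theorem doubleCoset_join_of_eq.{u, v, w} :
    (∀ (G : Type u) [Group G] (g : G) (H₁ H₂ K₁ K₂ : Subgroup G),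
      grpDoubleCoset H₁ g K₁ = grpDoubleCoset H₂ g K₂ →
        grpDoubleCoset H₁ g K₁ = grpDoubleCoset (H₁ ⊔ H₂) g (K₁ ⊔ K₂)) ∧
    (∀ (B : Type v) (W : Type w) [Group W] (M : CoxeterMatrix B)
      (cs : CoxeterSystem M W) (I I' J J' : Set B) (w : W),
      grpDoubleCoset (cs.parabolic I) w (cs.parabolic J) =
        grpDoubleCoset (cs.parabolic I') w (cs.parabolic J') →
      grpDoubleCoset (cs.parabolic I) w (cs.parabolic J) =
        grpDoubleCoset (cs.parabolic (I ∪ I')) w (cs.parabolic (J ∪ J'))) := by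
  refine ⟨fun G _ g H₁ H₂ K₁ K₂ h => grpDoubleCoset_eq_sup_of_eq h, ?_⟩
  intro B W _ M cs I I' J J' w h
  rw [cs.parabolic_union, cs.parabolic_union]
  exact grpDoubleCoset_eq_sup_of_eq h
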